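/- Let 0 < α < n, let Φ, Ψ be Orlicz functions, and let either 0 < λ, μ < 1 with λ ≠ μ, or λ = μ = 0. Assume there exist constants C₄, C₅ ≥ 1 such that ∫_u^∞ t^{α/n} Φ⁻¹(t^{λ−1}) dt/t ≤ C₄ Ψ⁻¹(u^{μ−1}) for all u > 0, and ∫_u^∞ t^{α/n} Φ⁻¹(r^λ/t) dt/t ≤ C₅ Ψ⁻¹(r^μ/u) for all u > 0 and all r > 0. If Φ* ∈ Δ₂, then the Riesz potential I_α is bounded from M^{Φ,λ}(0) to M^{Ψ,μ}(0): there exists a constant C₆ ≥ 1 such that ‖I_α f‖_{M^{Ψ,μ}(0)} ≤ C₆ ‖f‖_{M^{Φ,λ}(0)} for all f ∈ M^{Φ,λ}(0). -/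

import Mathlib

open MeasureTheory Metric Set Filter ENNReal NNReal Topology

noncomputable section

/-- ℝⁿ as Euclidean space. -/
abbrev Eu (n : ℕ) : Type := EuclideanSpace ℝ (Fin n)

/-- The (right-continuous) generalized inverse `Φ⁻¹(v) = inf {u ≥ 0 : Φ(u) > v}`
(with `inf ∅ = ∞`). -/
def yInv (Φ : ℝ≥0∞ → ℝ≥0∞) (v : ℝ≥0∞) : ℝ≥0∞ := sInf {u : ℝ≥0∞ | v < Φ u}

/-- The complementary (conjugate) function `Φ*(v) = sup_{u > 0} (u⬝v − Φ(u))`. -/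
def yConj (Φ : ℝ≥0∞ → ℝ≥0∞) (v : ℝ≥0∞) : ℝ≥0∞ :=
  ⨆ (u : ℝ≥0∞) (_ : 0 < u) (_ : u ≠ ∞), u * v - Φ u

/-- The dilation function `s_{Φ⁻¹}(t) = sup_{s > 0} Φ⁻¹(st)/Φ⁻¹(s)`. -/
def sDil (Φ : ℝ≥0∞ → ℝ≥0∞) (t : ℝ≥0∞) : ℝ≥0∞ :=
  ⨆ (s : ℝ≥0∞) (_ : 0 < s) (_ : s ≠ ∞), yInv Φ (s * t) / yInv Φ s

/-- A Young function: nondecreasing, convex, `Φ(0) = 0 = lim_{u→0+} Φ(u)`, not identically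
`0` nor `∞` on `(0,∞)`, and left continuous (values in `[0,∞]`, the value at `∞` being the
canonical/limit extension). -/
structure IsYoungFn (Φ : ℝ≥0∞ → ℝ≥0∞) : Prop where
  mono : Monotone Φ
  map_zero : Φ 0 = 0
  tendsto_zero : Filter.Tendsto Φ (nhdsWithin 0 (Set.Ioi 0)) (nhds 0)
  convex : ∀ a b t : ℝ≥0∞, t ≤ 1 → Φ (t * a + (1 - t) * b) ≤ t * Φ a + (1 - t) * Φ b
  not_zero : ∃ u : ℝ≥0∞, 0 < u ∧ u ≠ ∞ ∧ Φ u ≠ 0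
  not_top : ∃ u : ℝ≥0∞, 0 < u ∧ u ≠ ∞ ∧ Φ u ≠ ∞
  left_cont : ∀ u : ℝ≥0∞, 0 < u → Filter.Tendsto Φ (nhdsWithin u (Set.Iio u)) (nhds (Φ u))

/-- An Orlicz function: increasing, continuous, convex, `Φ(0) = 0`, finite on `[0,∞)`
(the value at `∞` being the canonical extension `Φ(∞) = ∞`). -/
structure IsOrliczFn (Φ : ℝ≥0∞ → ℝ≥0∞) : Prop where
  map_zero : Φ 0 = 0
  strictMono : StrictMono Φ
  continuous : Continuous Φ
  convex : ∀ a b t : ℝ≥0∞, t ≤ 1 → Φ (t * a + (1 - t) * b) ≤ t * Φ a + (1 - t) * Φ b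
  finite : ∀ u : ℝ≥0∞, u ≠ ∞ → Φ u ≠ ∞
  map_top : Φ ∞ = ∞

/-- The Δ₂-condition: `0 < Φ(u) < ∞` for `0 < u < ∞` and `Φ(2u) ≤ D₂ Φ(u)` for some `D₂ ≥ 1`. -/
def IsDelta2 (Φ : ℝ≥0∞ → ℝ≥0∞) : Prop :=
  (∀ u : ℝ≥0∞, 0 < u → u ≠ ∞ → 0 < Φ u ∧ Φ u ≠ ∞) ∧
    ∃ D : ℝ≥0∞, 1 ≤ D ∧ D ≠ ∞ ∧ ∀ u : ℝ≥0∞, u ≠ ∞ → Φ (2 * u) ≤ D * Φ u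

/-- The Luxemburg-type functional `‖f‖_{Φ,λ,A}`. -/
def orliczNorm {n : ℕ} (Φ : ℝ≥0∞ → ℝ≥0∞) (lam : ℝ) (A : Set (Eu n)) (f : Eu n → ℝ) : ℝ≥0∞ :=
  sInf {ε : ℝ≥0∞ | 0 < ε ∧ ε ≠ ∞ ∧
    volume A ^ (-lam) * ∫⁻ x in A, Φ ((‖f x‖₊ : ℝ≥0∞) / ε) ≤ 1}

/-- The weak Luxemburg-type functional `‖f‖_{Φ,λ,A,∞}`. -/
def orliczWeakNorm {n : ℕ} (Φ : ℝ≥0∞ → ℝ≥0∞) (lam : ℝ) (A : Set (Eu n)) (f : Eu n → ℝ) : ℝ≥0∞ :=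
  sInf {ε : ℝ≥0∞ | 0 < ε ∧ ε ≠ ∞ ∧
    (⨆ (u : ℝ≥0) (_ : 0 < u),
      Φ ((u : ℝ≥0∞) / ε) * (volume A ^ (-lam) * volume {x ∈ A | u < ‖f x‖₊})) ≤ 1}

/-- The central Morrey–Orlicz norm `‖f‖_{M^{Φ,λ}(0)} = sup_{r>0} ‖f‖_{Φ,λ,B_r}`. -/
def centralNorm {n : ℕ} (Φ : ℝ≥0∞ → ℝ≥0∞) (lam : ℝ) (f : Eu n → ℝ) : ℝ≥0∞ :=
  ⨆ (r : ℝ) (_ : 0 < r), orliczNorm Φ lam (ball (0 : Eu n) r) f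

/-- The weak central Morrey–Orlicz norm `‖f‖_{WM^{Φ,λ}(0)} = sup_{r>0} ‖f‖_{Φ,λ,B_r,∞}`. -/
def centralWeakNorm {n : ℕ} (Φ : ℝ≥0∞ → ℝ≥0∞) (lam : ℝ) (f : Eu n → ℝ) : ℝ≥0∞ :=
  ⨆ (r : ℝ) (_ : 0 < r), orliczWeakNorm Φ lam (ball (0 : Eu n) r) f

/-- The Riesz potential `I_α f(x) = ∫ f(y) |x−y|^{α−n} dy`. -/
def riesz {n : ℕ} (α : ℝ) (f : Eu n → ℝ) (x : Eu n) : ℝ :=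
  ∫ y, f y / ‖x - y‖ ^ ((n : ℝ) - α)

/-- The classical Morrey norm `‖f‖_{M^{p,λ}}`. -/
def morreyNormP {n : ℕ} (p lam : ℝ) (f : Eu n → ℝ) : ℝ≥0∞ :=
  ⨆ (x₀ : Eu n) (r : ℝ) (_ : 0 < r),
    (volume (ball x₀ r) ^ (-lam) * ∫⁻ x in ball x₀ r, (‖f x‖₊ : ℝ≥0∞) ^ p) ^ (1 / p)

/-- The classical central Morrey norm `‖f‖_{M^{p,λ}(0)}`. -/
def centralNormP {n : ℕ} (p lam : ℝ) (f : Eu n → ℝ) : ℝ≥0∞ :=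
  ⨆ (r : ℝ) (_ : 0 < r),
    (volume (ball (0 : Eu n) r) ^ (-lam) * ∫⁻ x in ball (0 : Eu n) r, (‖f x‖₊ : ℝ≥0∞) ^ p) ^ (1 / p)

namespace IsOrliczFn

variable {Φ : ℝ≥0∞ → ℝ≥0∞}

lemma surjective (h : IsOrliczFn Φ) : Function.Surjective Φ := fun v ↦ by
  have := intermediate_value_univ 0 ∞ h.continuous
  rw [h.map_zero, h.map_top] at this
  exact this ⟨zero_le, le_top⟩

lemma yInv_apply (h : IsOrliczFn Φ) (u : ℝ≥0∞) : yInv Φ (Φ u) = u := by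
  refine le_antisymm (le_of_forall_gt_imp_ge_of_dense fun w hw ↦ sInf_le (h.strictMono hw)) ?_
  exact le_sInf fun w hw ↦ (h.strictMono.lt_iff_lt.1 hw).le

lemma apply_yInv (h : IsOrliczFn Φ) (v : ℝ≥0∞) : Φ (yInv Φ v) = v := by
  obtain ⟨u, rfl⟩ := h.surjective v
  rw [h.yInv_apply]

lemma le_yInv_iff (h : IsOrliczFn Φ) {u v : ℝ≥0∞} : u ≤ yInv Φ v ↔ Φ u ≤ v := by
  rw [← h.strictMono.le_iff_le, h.apply_yInv]

lemma yInv_mono (h : IsOrliczFn Φ) : Monotone (yInv Φ) := fun a b hab ↦ by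
  rwa [h.le_yInv_iff, h.apply_yInv]

lemma yInv_ne_top (h : IsOrliczFn Φ) {v : ℝ≥0∞} (hv : v ≠ ∞) : yInv Φ v ≠ ∞ := fun e ↦ by
  have := h.apply_yInv v
  rw [e, h.map_top] at this
  exact hv this.symm

lemma pos (h : IsOrliczFn Φ) {u : ℝ≥0∞} (hu : 0 < u) : 0 < Φ u := by
  simpa [h.map_zero] using h.strictMono hu

lemma measurable (h : IsOrliczFn Φ) : Measurable Φ := h.continuous.measurable

lemma apply_mul_le (h : IsOrliczFn Φ) {t : ℝ≥0∞} (ht : t ≤ 1) (u : ℝ≥0∞) :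
    Φ (t * u) ≤ t * Φ u := by
  simpa [h.map_zero] using h.convex u 0 t ht

lemma apply_div_le (h : IsOrliczFn Φ) {K : ℝ≥0∞} (hK : 1 ≤ K) (u : ℝ≥0∞) :
    Φ (u / K) ≤ Φ u / K := by
  rw [div_eq_mul_inv, mul_comm, div_eq_mul_inv, mul_comm (Φ u)]
  exact h.apply_mul_le (ENNReal.inv_le_one.2 hK) u

lemma apply_midpoint_le (h : IsOrliczFn Φ) (u v : ℝ≥0∞) :
    Φ ((u + v) / 2) ≤ (Φ u + Φ v) / 2 := by
  have := h.convex u v 2⁻¹ (by simp)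
  rw [ENNReal.one_sub_inv_two, ← mul_add, ← mul_add] at this
  simpa [div_eq_mul_inv, mul_comm] using this

lemma yInv_le_two_mul (h : IsOrliczFn Φ) (v : ℝ≥0∞) : yInv Φ v ≤ 2 * yInv Φ (v / 2) := by
  have : yInv Φ v / 2 ≤ yInv Φ (v / 2) := by
    rw [h.le_yInv_iff]
    simpa [h.apply_yInv] using h.apply_div_le (K := 2) (by norm_num) (yInv Φ v)
  rw [mul_comm]
  exact (ENNReal.div_le_iff (by simp) (by simp)).1 this

/-- A crude form of Jensen's inequality. -/
lemma lintegral_le (h : IsOrliczFn Φ) {X : Type*} [MeasurableSpace X] (ν : Measure X)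
    {g : X → ℝ≥0∞} {T v : ℝ≥0∞} (hT : ν univ ≤ T) (hT0 : T ≠ 0) (hT1 : T ≠ ∞) (hv0 : v ≠ 0)
    (hv1 : v ≠ ∞) (hg : ∫⁻ x, Φ (g x) ∂ν ≤ v) :
    ∫⁻ x, g x ∂ν ≤ 2 * T * yInv Φ (v / T) := by
  set m := yInv Φ (v / T) with hm
  have hΦm : Φ m = v / T := h.apply_yInv _
  have hvT0 : v / T ≠ 0 := (ENNReal.div_pos hv0 hT1).ne'
  have hvT1 : v / T ≠ ∞ := ENNReal.div_ne_top hv1 hT0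
  have hm1 : m ≠ ∞ := h.yInv_ne_top hvT1
  have key : ∀ w, w ≤ m + m / Φ m * Φ w := by
    intro w
    rcases le_total w m with hw | hw
    · exact le_add_right hw
    refine le_add_left ?_
    rcases eq_or_ne w ∞ with rfl | hw1
    · have : m / Φ m ≠ 0 := by
        refine (ENNReal.div_pos (fun e ↦ hvT0 ?_) (hΦm ▸ hvT1)).ne'
        rw [← hΦm, e, h.map_zero]
      rw [h.map_top, ENNReal.mul_top this]
    have hm0 : m ≠ 0 := fun e ↦ hvT0 (by rw [← hΦm, e, h.map_zero])
    have hw0 : w ≠ 0 := fun e ↦ hm0 (by simpa [e] using hw)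
    have h1 : Φ m ≤ m / w * Φ w := by
      have := h.apply_mul_le (t := m / w) (ENNReal.div_le_of_le_mul (by simpa using hw)) w
      rwa [ENNReal.div_mul_cancel hw0 hw1] at this
    calc w = w / Φ m * Φ m := (ENNReal.div_mul_cancel (hΦm ▸ hvT0) (hΦm ▸ hvT1)).symm
      _ ≤ w / Φ m * (m / w * Φ w) := by gcongr
      _ = (w / w) * (m / Φ m * Φ w) := by simp only [div_eq_mul_inv]; ring
      _ = _ := by rw [ENNReal.div_self hw0 hw1, one_mul]
  calc ∫⁻ x, g x ∂ν ≤ ∫⁻ x, (m + m / Φ m * Φ (g x)) ∂ν := lintegral_mono fun x ↦ key _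
    _ = m * ν univ + m / Φ m * ∫⁻ x, Φ (g x) ∂ν := by
      rw [lintegral_add_left measurable_const, lintegral_const, lintegral_const_mul']
      exact ENNReal.div_ne_top hm1 (hΦm ▸ hvT0)
    _ ≤ m * T + m / Φ m * v := by gcongr
    _ = m * T + m * T := by
      rw [hΦm]
      congr 1
      rw [div_eq_mul_inv m, ENNReal.inv_div (Or.inl hT1) (Or.inl hT0), mul_assoc,
        ENNReal.div_mul_cancel hv0 hv1]
    _ = _ := by ring

lemma exists_subgradient (h : IsOrliczFn Φ) {w : ℝ≥0∞} (hw0 : w ≠ 0) (hw1 : w ≠ ∞) :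
    ∃ p : ℝ≥0∞, p ≠ ∞ ∧ ∀ u, u ≠ ∞ → Φ w + p * u ≤ Φ u + p * w := by
  set φ : ℝ → ℝ := fun x ↦ (Φ (ENNReal.ofReal x)).toReal with hφ
  have hc : ConvexOn ℝ (Ici 0) φ := by
    refine ⟨convex_Ici 0, fun x hx y hy s t hs ht hst ↦ ?_⟩
    rw [mem_Ici] at hx hy
    have h1 := h.convex (ENNReal.ofReal x) (ENNReal.ofReal y) (ENNReal.ofReal s)
      (by rw [ENNReal.ofReal_le_one]; linarith)
    have h2 : 1 - ENNReal.ofReal s = ENNReal.ofReal t := by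
      rw [← ENNReal.ofReal_one, ← ENNReal.ofReal_sub _ hs, ← hst]
      simp
    rw [h2, ← ENNReal.ofReal_mul hs, ← ENNReal.ofReal_mul ht,
      ← ENNReal.ofReal_add (by positivity) (by positivity)] at h1
    have h3 := ENNReal.toReal_mono (by
      refine ENNReal.add_ne_top.2 ⟨ENNReal.mul_ne_top (by simp) (h.finite _ (by simp)),
        ENNReal.mul_ne_top (by simp) (h.finite _ (by simp))⟩) h1
    rw [ENNReal.toReal_add (ENNReal.mul_ne_top (by simp) (h.finite _ (by simp)))
        (ENNReal.mul_ne_top (by simp) (h.finite _ (by simp))), ENNReal.toReal_mul,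
        ENNReal.toReal_mul, ENNReal.toReal_ofReal hs, ENNReal.toReal_ofReal ht] at h3
    simpa [hφ] using h3
  set x := w.toReal with hx
  have hx0 : 0 < x := ENNReal.toReal_pos hw0 hw1
  have hxi : x ∈ interior (Ici (0 : ℝ)) := by simpa using hx0
  set q := derivWithin φ (Ioi x) x with hq
  have hsub : ∀ y, 0 ≤ y → φ x + q * y ≤ φ y + q * x := by
    intro y hy
    rcases lt_trichotomy y x with hyx | rfl | hyx
    · have h1 := (hc.slope_le_leftDeriv_of_mem_interior (x := y) hy hxi hyx).trans
        (hc.leftDeriv_le_rightDeriv_of_mem_interior hxi)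
      rw [slope_def_field, div_le_iff₀ (by linarith)] at h1
      rw [← hq] at h1
      linarith
    · rfl
    · have h1 := hc.rightDeriv_le_slope_of_mem_interior (y := y) hxi hy hyx
      rw [slope_def_field, le_div_iff₀ (by linarith)] at h1
      rw [← hq] at h1
      linarith
  have hq0 : 0 ≤ q := by
    have h1 := hsub 0 le_rfl
    have h2 : φ 0 = 0 := by simp [hφ, h.map_zero]
    have h3 : 0 ≤ φ x := ENNReal.toReal_nonneg
    rw [h2] at h1
    by_contra! hneg
    nlinarith
  refine ⟨ENNReal.ofReal q, by simp, fun u hu ↦ ?_⟩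
  have h1 := hsub u.toReal ENNReal.toReal_nonneg
  have e1 : Φ w = ENNReal.ofReal (φ x) := by simp [hφ, hx, hw1, h.finite]
  have e2 : Φ u = ENNReal.ofReal (φ u.toReal) := by simp [hφ, hu, h.finite]
  have e3 : ∀ z, 0 ≤ φ z := fun z ↦ ENNReal.toReal_nonneg
  have hu0 : 0 ≤ u.toReal := ENNReal.toReal_nonneg
  rw [e1, e2, ← ENNReal.ofReal_toReal hu, ← ENNReal.ofReal_toReal hw1, ← ENNReal.ofReal_mul hq0,
    ← ENNReal.ofReal_mul hq0, ← ENNReal.ofReal_add (e3 _) (by positivity),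
    ← ENNReal.ofReal_add (e3 _) (by positivity)]
  apply ENNReal.ofReal_le_ofReal
  simpa [ENNReal.toReal_ofReal hu0] using h1

/-- If the complementary function is doubling, then `Φ` satisfies the `∇₂`-condition. -/
lemma exists_nabla2 (h : IsOrliczFn Φ) (hΔ : IsDelta2 (yConj Φ)) :
    ∃ a : ℝ≥0∞, 2 ≤ a ∧ a ≠ ∞ ∧ ∀ w, 2 * a * Φ w ≤ Φ (a * w) := by
  obtain ⟨-, D₀, -, hD₀, hD⟩ := hΔ
  set a : ℝ≥0∞ := D₀ + 2 with ha
  have ha2 : 2 ≤ a := le_add_self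
  have ha1 : a ≠ ∞ := by simp [ha, hD₀]
  have ha0 : a ≠ 0 := fun e ↦ by simp [e] at ha2
  refine ⟨a, ha2, ha1, fun w ↦ ?_⟩
  rcases eq_or_ne w 0 with rfl | hw0
  · simp [h.map_zero]
  rcases eq_or_ne w ∞ with rfl | hw1
  · simp [ENNReal.mul_top ha0, h.map_top]
  obtain ⟨p, hp, hsub⟩ := h.exists_subgradient hw0 hw1
  have hpw : p * w ≠ ∞ := ENNReal.mul_ne_top hp hw1
  have hle : Φ w ≤ p * w := by simpa [h.map_zero] using hsub 0 (by simp)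
  have h1 : yConj Φ p ≤ p * w - Φ w := by
    refine iSup_le fun u ↦ iSup_le fun _ ↦ iSup_le fun hu ↦ ?_
    rw [tsub_le_iff_right]
    have h2 := hsub u hu
    have h3 : u * p + Φ w ≤ (p * w - Φ w + Φ u) + Φ w := by
      calc u * p + Φ w = Φ w + p * u := by ring
        _ ≤ Φ u + p * w := h2
        _ = Φ u + (p * w - Φ w + Φ w) := by rw [tsub_add_cancel_of_le hle]
        _ = _ := by ring
    exact (ENNReal.add_le_add_iff_right (h.finite _ hw1)).1 h3
  have haw : a * w ≠ ∞ := ENNReal.mul_ne_top ha1 hw1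
  have h2 : a * w * (2 * p) - Φ (a * w) ≤ 2 * a * (p * w - Φ w) := by
    calc a * w * (2 * p) - Φ (a * w) ≤ yConj Φ (2 * p) :=
          le_iSup_of_le (a * w) (le_iSup_of_le (by positivity) (le_iSup_of_le haw le_rfl))
      _ ≤ D₀ * yConj Φ p := hD p hp
      _ ≤ _ := by
        gcongr
        calc D₀ ≤ a := le_self_add
          _ ≤ a + a := le_self_add
          _ = 2 * a := by ring
  rw [tsub_le_iff_right] at h2
  have h3 : 2 * a * Φ w + 2 * a * (p * w - Φ w) ≤ Φ (a * w) + 2 * a * (p * w - Φ w) := by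
    calc 2 * a * Φ w + 2 * a * (p * w - Φ w) = 2 * a * (p * w - Φ w + Φ w) := by ring
      _ = a * w * (2 * p) := by rw [tsub_add_cancel_of_le hle]; ring
      _ ≤ _ := h2
      _ = _ := add_comm _ _
  refine (ENNReal.add_le_add_iff_right ?_).1 h3
  exact ENNReal.mul_ne_top (by finiteness) (ENNReal.sub_ne_top hpw)

lemma apply_le_tsum (h : IsOrliczFn Φ) {a : ℝ≥0∞} (ha : 1 < a) (ha1 : a ≠ ∞) (w : ℝ≥0∞) :
    Φ w ≤ ∑' j : ℤ, (Ioi (Φ (a ^ j))).indicator (fun _ ↦ Φ (a ^ (j + 1))) (Φ w) := by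
  have hmem : ∀ j : ℤ, a ^ j < w → Φ (a ^ (j + 1)) ≤
      ∑' j : ℤ, (Ioi (Φ (a ^ j))).indicator (fun _ ↦ Φ (a ^ (j + 1))) (Φ w) := by
    intro j hj
    refine le_trans (le_of_eq ?_) (ENNReal.le_tsum j)
    rw [indicator_of_mem]
    exact h.strictMono hj
  rcases eq_or_ne w 0 with rfl | hw0
  · simp [h.map_zero]
  rcases eq_or_ne w ∞ with rfl | hw1
  · have ha0 : a ≠ 0 := (zero_lt_one.trans ha).ne'
    have hlim : Tendsto (fun j : ℕ ↦ Φ (a ^ (((j : ℕ) : ℤ) + 1))) atTop (𝓝 ∞) := by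
      rw [← h.map_top]
      refine (h.continuous.tendsto _).comp ?_
      have := (ENNReal.tendsto_pow_atTop_nhds_top_iff.2 ha).comp (tendsto_add_atTop_nat 1)
      refine this.congr fun j ↦ ?_
      simp only [Function.comp]
      exact_mod_cast rfl
    refine h.map_top.trans_le (le_of_tendsto hlim (Eventually.of_forall fun j ↦ hmem _ ?_))
    exact (ENNReal.zpow_lt_top ha0 ha1 _)
  obtain ⟨j, hj1, hj2⟩ := ENNReal.exists_mem_Ioc_zpow hw0 hw1 ha ha1
  exact (h.strictMono.monotone hj2).trans (hmem j hj1)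

lemma tsum_indicator_le (h : IsOrliczFn Φ) {a : ℝ≥0∞} (ha : 2 ≤ a) (ha1 : a ≠ ∞)
    (hnabla : ∀ w, 2 * a * Φ w ≤ Φ (a * w)) (w : ℝ≥0∞) :
    ∑' j : ℤ, (Ioi (a ^ j)).indicator (fun w ↦ Φ (a ^ (j + 1)) * (a ^ j)⁻¹ * w) w
      ≤ 2 * a * Φ (a * w) := by
  have ha' : 1 < a := lt_of_lt_of_le (by norm_num) ha
  have ha0 : a ≠ 0 := (zero_lt_one.trans ha').ne'
  rcases eq_or_ne w 0 with rfl | hw0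
  · simp
  rcases eq_or_ne w ∞ with rfl | hw1
  · rw [ENNReal.mul_top ha0, h.map_top, ENNReal.mul_top (by simpa using ha0)]
    exact le_top
  obtain ⟨J, hJ1, hJ2⟩ := ENNReal.exists_mem_Ioc_zpow hw0 hw1 ha' ha1
  set b : ℤ → ℝ≥0∞ := fun j ↦ Φ (a ^ (j + 1)) * (a ^ j)⁻¹ with hb
  have hpow : ∀ j : ℤ, a ^ (j + 1) = a ^ j * a := fun j ↦ by
    rw [ENNReal.zpow_add ha0 ha1, zpow_one]
  have hb1 : ∀ j, b (j - 1) ≤ 2⁻¹ * b j := by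
    intro j
    have h1 := hnabla (a ^ j)
    rw [mul_comm a (a ^ j), ← hpow] at h1
    have h2 : (a ^ (j - 1))⁻¹ = a * (a ^ j)⁻¹ := by
      rw [← ENNReal.zpow_neg, ← ENNReal.zpow_neg]
      have := hpow (-j)
      rw [mul_comm, ← this]
      congr 1
      ring
    simp only [hb, sub_add_cancel, h2]
    calc Φ (a ^ j) * (a * (a ^ j)⁻¹) = 2⁻¹ * 2 * (Φ (a ^ j) * (a * (a ^ j)⁻¹)) := by
          rw [ENNReal.inv_mul_cancel (by simp) (by simp), one_mul]
      _ = 2⁻¹ * (2 * a * Φ (a ^ j) * (a ^ j)⁻¹) := by ring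
      _ ≤ _ := by gcongr
  have hb2 : ∀ i : ℕ, b (J - i) ≤ 2⁻¹ ^ i * b J := by
    intro i
    induction i with
    | zero => simp
    | succ i ih =>
      calc b (J - ((i + 1 : ℕ) : ℤ)) = b (J - i - 1) := by push_cast; congr 1; ring
        _ ≤ 2⁻¹ * b (J - i) := hb1 _
        _ ≤ 2⁻¹ * (2⁻¹ ^ i * b J) := by gcongr
        _ = _ := by ring
  have hinj : Function.Injective (fun i : ℕ ↦ J - (i : ℤ)) := fun i j hij ↦ by
    simpa using hij
  have hsupp : Function.support (fun j : ℤ ↦ (Ioi (a ^ j)).indicator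
      (fun w ↦ Φ (a ^ (j + 1)) * (a ^ j)⁻¹ * w) w) ⊆ range (fun i : ℕ ↦ J - (i : ℤ)) := by
    intro j hj
    have hj' : a ^ j < w := by
      by_contra hc
      exact hj (indicator_of_notMem (s := Ioi (a ^ j)) hc _)
    have : a ^ j < a ^ (J + 1) := hj'.trans_le hJ2
    have hlt : j < J + 1 := by
      by_contra! hc
      exact absurd (ENNReal.monotone_zpow ha'.le hc) (not_le.2 this)
    exact ⟨(J - j).toNat, by simp; omega⟩
  rw [← hinj.tsum_eq hsupp]
  calc ∑' i : ℕ, (Ioi (a ^ (J - (i : ℤ)))).indicator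
        (fun w ↦ Φ (a ^ (J - (i : ℤ) + 1)) * (a ^ (J - (i : ℤ)))⁻¹ * w) w
      ≤ ∑' i : ℕ, 2⁻¹ ^ i * (b J * w) := by
        refine ENNReal.tsum_le_tsum fun i ↦ ?_
        refine (indicator_le_self _ _ _).trans ?_
        calc b (J - i) * w ≤ 2⁻¹ ^ i * b J * w := by gcongr; exact hb2 i
          _ = _ := by ring
    _ = 2 * (b J * w) := by rw [ENNReal.tsum_mul_right, ENNReal.tsum_geometric_two]
    _ ≤ 2 * (b J * (a ^ J * a)) := by gcongr; rw [← hpow]; exact hJ2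
    _ = 2 * a * Φ (a ^ (J + 1)) := by
      have hz0 : a ^ J ≠ 0 := (ENNReal.zpow_pos ha0 ha1 J).ne'
      have hz1 : a ^ J ≠ ∞ := (ENNReal.zpow_lt_top ha0 ha1 J).ne
      simp only [hb]
      calc 2 * (Φ (a ^ (J + 1)) * (a ^ J)⁻¹ * (a ^ J * a))
          = 2 * a * Φ (a ^ (J + 1)) * ((a ^ J)⁻¹ * a ^ J) := by ring
        _ = _ := by rw [ENNReal.inv_mul_cancel hz0 hz1, mul_one]
    _ ≤ 2 * a * Φ (a * w) := by
      gcongr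
      apply h.strictMono.monotone
      rw [hpow, mul_comm]
      gcongr

end IsOrliczFn

/-- The volume of the unit ball of `ℝⁿ`. -/
def unitVol (n : ℕ) : ℝ := (volume (ball (0 : Eu n) 1)).toReal

/-- The volume of the ball of radius `‖z‖`. -/
def ballVol {n : ℕ} (z : Eu n) : ℝ := unitVol n * ‖z‖ ^ n

/-- The ball with centre `x` and volume `t`. -/
def volBall {n : ℕ} (x : Eu n) (t : ℝ) : Set (Eu n) := {y | ballVol (x - y) < t}

/-- The kernel `∫_{ω(z)}^∞ t^(β-2) dt`, `ω(z)` being the volume of the ball of radius `‖z‖`; it is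
a multiple of `‖z‖^(n(β-1))`. -/
def radialKer {n : ℕ} (β : ℝ) (z : Eu n) : ℝ≥0∞ :=
  ∫⁻ t in Ioi (ballVol z), ENNReal.ofReal (t ^ (β - 2))

section Kernel

variable {n : ℕ}

lemma unitVol_pos : 0 < unitVol n :=
  ENNReal.toReal_pos (measure_ball_pos _ _ one_pos).ne' measure_ball_lt_top.ne

lemma ballVol_nonneg (z : Eu n) : 0 ≤ ballVol z := by
  have := unitVol_pos (n := n)
  unfold ballVol
  positivity

lemma continuous_ballVol : Continuous (ballVol (n := n)) := by
  unfold ballVol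
  fun_prop

lemma ballVol_neg (z : Eu n) : ballVol (-z) = ballVol z := by simp [ballVol]

lemma radialKer_sub_comm (β : ℝ) (x y : Eu n) : radialKer β (x - y) = radialKer β (y - x) := by
  rw [radialKer, radialKer, ← neg_sub, ballVol_neg]

lemma mem_volBall_comm {x y : Eu n} {t : ℝ} : y ∈ volBall x t ↔ x ∈ volBall y t := by
  rw [volBall, volBall, mem_ofPred_eq, mem_ofPred_eq, ← neg_sub, ballVol_neg]

lemma measurableSet_volBall (x : Eu n) (t : ℝ) : MeasurableSet (volBall x t) :=
  measurableSet_lt (continuous_ballVol.comp (by fun_prop)).measurable measurable_const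

lemma ball_eq_volBall (hn : n ≠ 0) (x : Eu n) {r : ℝ} (hr : 0 < r) :
    ball x r = volBall x (unitVol n * r ^ n) := by
  ext y
  rw [mem_ball', volBall, mem_ofPred_eq, ballVol, mul_lt_mul_iff_right₀ unitVol_pos,
    pow_lt_pow_iff_left₀ (norm_nonneg _) hr.le hn, dist_eq_norm]

lemma volume_ball_eq (x : Eu n) {r : ℝ} (hr : 0 < r) :
    volume (ball x r) = ENNReal.ofReal (unitVol n * r ^ n) := by
  rw [Measure.addHaar_ball_of_pos _ _ hr, unitVol, mul_comm,
    ENNReal.ofReal_mul ENNReal.toReal_nonneg, ENNReal.ofReal_toReal measure_ball_lt_top.ne,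
    mul_comm]
  simp [mul_comm]

lemma exists_radius (hn : n ≠ 0) {t : ℝ} (ht : 0 < t) : ∃ r > 0, t = unitVol n * r ^ n := by
  have := unitVol_pos (n := n)
  refine ⟨(t / unitVol n) ^ ((n : ℝ)⁻¹), by positivity, ?_⟩
  rw [Real.rpow_inv_natCast_pow (by positivity) hn]
  field_simp

lemma volume_volBall (hn : n ≠ 0) (x : Eu n) {t : ℝ} (ht : 0 < t) :
    volume (volBall x t) = ENNReal.ofReal t := by
  obtain ⟨r, hr, rfl⟩ := exists_radius hn ht
  rw [← ball_eq_volBall hn x hr, volume_ball_eq x hr]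

lemma radialKer_eq_lintegral_indicator (β : ℝ) (z : Eu n) :
    radialKer β z = ∫⁻ t in Ioi (0 : ℝ),
      {p : Eu n × ℝ | ballVol p.1 < p.2}.indicator (fun p ↦ ENNReal.ofReal (p.2 ^ (β - 2)))
        (z, t) := by
  have : Ioi (ballVol z) = Ioi (0 : ℝ) ∩ Ioi (ballVol z) := by
    rw [Ioi_inter_Ioi, sup_eq_right.2 (ballVol_nonneg z)]
  rw [radialKer, this, inter_comm, ← Measure.restrict_restrict measurableSet_Ioi,
    ← lintegral_indicator measurableSet_Ioi]
  rfl

lemma measurable_radialKer (β : ℝ) : Measurable (radialKer (n := n) β) := by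
  rw [funext (radialKer_eq_lintegral_indicator (n := n) β)]
  refine Measurable.lintegral_prod_right' (f := _) (Measurable.indicator ?_ ?_)
  · fun_prop
  · exact measurableSet_lt (continuous_ballVol.measurable.comp measurable_fst) measurable_snd

/-- The layer cake formula for the potential with kernel `radialKer`. -/
lemma lintegral_mul_radialKer (β : ℝ) {g : Eu n → ℝ≥0∞} (hg : Measurable g) (x : Eu n)
    (S : Set (Eu n)) :
    ∫⁻ y in S, g y * radialKer β (x - y) =
      ∫⁻ t in Ioi (0 : ℝ), ENNReal.ofReal (t ^ (β - 2)) * ∫⁻ y in volBall x t ∩ S, g y := by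
  have hset : MeasurableSet {p : Eu n × ℝ | ballVol (x - p.1) < p.2} :=
    measurableSet_lt (continuous_ballVol.measurable.comp (by fun_prop)) measurable_snd
  calc ∫⁻ y in S, g y * radialKer β (x - y)
      = ∫⁻ y in S, ∫⁻ t in Ioi (0 : ℝ), {p : Eu n × ℝ | ballVol (x - p.1) < p.2}.indicator
          (fun p ↦ g p.1 * ENNReal.ofReal (p.2 ^ (β - 2))) (y, t) := by
        refine lintegral_congr fun y ↦ ?_
        rw [radialKer_eq_lintegral_indicator, ← lintegral_const_mul]
        · refine lintegral_congr fun t ↦ ?_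
          by_cases h : ballVol (x - y) < t <;> simp [indicator, h]
        · refine Measurable.indicator (f := fun t : ℝ ↦ ENNReal.ofReal (t ^ (β - 2)))
            (s := Ioi (ballVol (x - y))) ?_ measurableSet_Ioi
          fun_prop
    _ = ∫⁻ t in Ioi (0 : ℝ), ∫⁻ y in S, {p : Eu n × ℝ | ballVol (x - p.1) < p.2}.indicator
          (fun p ↦ g p.1 * ENNReal.ofReal (p.2 ^ (β - 2))) (y, t) := by
        refine lintegral_lintegral_swap (Measurable.aemeasurable ?_)
        exact Measurable.indicator (by fun_prop) hset
    _ = _ := by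
        refine lintegral_congr fun t ↦ ?_
        rw [← Measure.restrict_restrict (measurableSet_volBall x t),
          ← lintegral_indicator (measurableSet_volBall x t),
          ← lintegral_const_mul _ (hg.indicator (measurableSet_volBall x t))]
        refine lintegral_congr fun y ↦ ?_
        by_cases h : ballVol (x - y) < t <;> simp [indicator, volBall, h, mul_comm]

lemma lintegral_compl_volBall_le (β : ℝ) {g : Eu n → ℝ≥0∞} (hg : Measurable g) (x : Eu n)
    {u : ℝ} (hu : 0 < u) :
    ∫⁻ y in (volBall x u)ᶜ, g y * radialKer β (x - y) ≤
      ∫⁻ t in Ioi u, ENNReal.ofReal (t ^ (β - 2)) * ∫⁻ y in volBall x t, g y := by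
  rw [lintegral_mul_radialKer β hg, ← lintegral_indicator measurableSet_Ioi,
    ← lintegral_indicator measurableSet_Ioi]
  refine lintegral_mono fun t ↦ ?_
  rcases le_or_gt t u with htu | htu
  · have : volBall x t ∩ (volBall x u)ᶜ = ∅ := by
      ext y
      simp only [volBall, mem_inter_iff, mem_ofPred_eq, mem_compl_iff, mem_empty_iff_false]
      refine iff_of_false (fun h ↦ ?_) id
      linarith [h.1]
    simp [indicator, this]
  · rw [indicator_of_mem (mem_Ioi.2 (hu.trans htu)), indicator_of_mem (mem_Ioi.2 htu)]
    gcongr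
    exact inter_subset_left

lemma lintegral_Ioi_rpow {β : ℝ} (hβ : β < 1) {u : ℝ} (hu : 0 < u) :
    ∫⁻ t in Ioi u, ENNReal.ofReal (t ^ (β - 2)) = ENNReal.ofReal (u ^ (β - 1) / (1 - β)) := by
  rw [← ofReal_integral_eq_lintegral_ofReal (integrableOn_Ioi_rpow_of_lt (by linarith) hu),
    integral_Ioi_rpow_of_lt (by linarith) hu]
  · congr 1
    rw [show β - 2 + 1 = -(1 - β) by ring, neg_div_neg_eq, neg_sub]
  · filter_upwards [ae_restrict_mem measurableSet_Ioi] with t ht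
    exact Real.rpow_nonneg (hu.trans ht).le _

lemma lintegral_volBall_radialKer_le (hn : n ≠ 0) {β : ℝ} (hβ0 : 0 < β) (hβ1 : β < 1) (x : Eu n)
    {u : ℝ} (hu : 0 < u) :
    ∫⁻ y in volBall x u, radialKer β (x - y) ≤
      ENNReal.ofReal (1 / β + 1 / (1 - β)) * ENNReal.ofReal (u ^ β) := by
  have h1 : ∀ t : ℝ, 0 < t → t ^ (β - 2) * t = t ^ (β - 1) := fun t ht ↦ by
    rw [← Real.rpow_add_one ht.ne']
    ring_nf
  have h_int : IntegrableOn (fun t : ℝ ↦ t ^ (β - 1)) (Ioc 0 u) :=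
    (intervalIntegrable_iff_integrableOn_Ioc_of_le hu.le).1
      (intervalIntegral.intervalIntegrable_rpow' (by linarith))
  have h2 := lintegral_mul_radialKer β (g := fun _ : Eu n ↦ 1) measurable_const x (volBall x u)
  simp only [one_mul] at h2
  rw [h2, ← Ioc_union_Ioi_eq_Ioi hu.le, lintegral_union measurableSet_Ioi
    (disjoint_left.2 fun t ht ht' ↦ not_lt.2 ht.2 ht')]
  have hA : ∫⁻ t in Ioc 0 u, ENNReal.ofReal (t ^ (β - 2)) * ∫⁻ y in volBall x t ∩ volBall x u, 1
      ≤ ENNReal.ofReal (u ^ β / β) := by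
    calc _ ≤ ∫⁻ t in Ioc 0 u, ENNReal.ofReal (t ^ (β - 1)) := by
          refine setLIntegral_mono (by fun_prop) fun t ht ↦ ?_
          rw [← h1 t ht.1, ENNReal.ofReal_mul (Real.rpow_nonneg ht.1.le _)]
          gcongr
          rw [setLIntegral_one, ← volume_volBall hn x ht.1]
          exact measure_mono inter_subset_left
      _ = ENNReal.ofReal (u ^ β / β) := by
          rw [← ofReal_integral_eq_lintegral_ofReal h_int,
            ← intervalIntegral.integral_of_le hu.le, integral_rpow (Or.inl (by linarith))]
          · simp [Real.zero_rpow hβ0.ne']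
          · filter_upwards [ae_restrict_mem measurableSet_Ioc] with t ht
            exact Real.rpow_nonneg ht.1.le _
  have hB : ∫⁻ t in Ioi u, ENNReal.ofReal (t ^ (β - 2)) * ∫⁻ y in volBall x t ∩ volBall x u, 1
      ≤ ENNReal.ofReal (u ^ β / (1 - β)) := by
    calc _ ≤ ∫⁻ t in Ioi u, ENNReal.ofReal (t ^ (β - 2)) * ENNReal.ofReal u := by
          refine lintegral_mono fun t ↦ ?_
          gcongr
          rw [setLIntegral_one, ← volume_volBall hn x hu]
          exact measure_mono inter_subset_right
      _ = ENNReal.ofReal (u ^ β / (1 - β)) := by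
          rw [lintegral_mul_const _ (by fun_prop), lintegral_Ioi_rpow hβ1 hu,
            ← ENNReal.ofReal_mul (by have := sub_pos.2 hβ1; positivity)]
          congr 1
          rw [div_mul_eq_mul_div, ← Real.rpow_add_one hu.ne']
          ring_nf
  refine (add_le_add hA hB).trans ?_
  have := sub_pos.2 hβ1
  rw [← ENNReal.ofReal_add (by positivity) (by positivity),
    ← ENNReal.ofReal_mul (by positivity)]
  apply ENNReal.ofReal_le_ofReal
  apply le_of_eq
  ring

lemma ofReal_rpow_norm_le_radialKer (hn : n ≠ 0) {α : ℝ} (hαn : α < n) (z : Eu n) :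
    ENNReal.ofReal (‖z‖ ^ (α - n)) ≤
      ENNReal.ofReal ((1 - α / n) * unitVol n ^ (1 - α / n)) * radialKer (α / n) z := by
  have hn' : (0 : ℝ) < n := by positivity
  have hβ : α / n < 1 := by rwa [div_lt_one hn']
  have hβ' := sub_pos.2 hβ
  have hκ := unitVol_pos (n := n)
  rcases eq_or_ne z 0 with rfl | hz
  · rw [norm_zero, Real.zero_rpow (by linarith)]
    simp
  have hz' : 0 < ‖z‖ := norm_pos_iff.2 hz
  rw [radialKer, lintegral_Ioi_rpow hβ (by unfold ballVol; positivity),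
    ← ENNReal.ofReal_mul (by positivity)]
  apply ENNReal.ofReal_le_ofReal
  apply le_of_eq
  rw [ballVol, Real.mul_rpow hκ.le (by positivity), ← Real.rpow_natCast, ← Real.rpow_mul hz'.le]
  have e1 : unitVol n ^ (1 - α / n) * unitVol n ^ (α / n - 1) = 1 := by
    rw [← Real.rpow_add hκ]
    simp
  have e2 : (n : ℝ) * (α / n - 1) = α - n := by field_simp
  rw [e2]
  calc ‖z‖ ^ (α - n) = (unitVol n ^ (1 - α / n) * unitVol n ^ (α / n - 1)) * ‖z‖ ^ (α - n) := by
        rw [e1, one_mul]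
    _ = _ := by
      generalize 1 - α / n = c at *
      field_simp

end Kernel

section Near

variable {n : ℕ} {Φ Ψ : ℝ≥0∞ → ℝ≥0∞} {β : ℝ}

/-- The potential of `g` with kernel `radialKer`. -/
def pot (β : ℝ) (g : Eu n → ℝ≥0∞) (x : Eu n) : ℝ≥0∞ := ∫⁻ y, g y * radialKer β (x - y)

lemma measurable_mul_radialKer {g : Eu n → ℝ≥0∞} (hg : Measurable g) :
    Measurable fun p : Eu n × Eu n ↦ g p.2 * radialKer β (p.1 - p.2) :=
  (hg.comp measurable_snd).mul ((measurable_radialKer β).comp (by fun_prop))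

lemma measurable_pot {g : Eu n → ℝ≥0∞} (hg : Measurable g) : Measurable (pot β g) :=
  (measurable_mul_radialKer hg).lintegral_prod_right'

lemma ofReal_rpow_mul_two_mul (v : ℝ≥0∞) {t : ℝ} (ht : 0 < t) :
    ENNReal.ofReal (t ^ (β - 2)) * (2 * ENNReal.ofReal t * v) =
      2 * (ENNReal.ofReal (t ^ β) * v / ENNReal.ofReal t) := by
  have h0 : ENNReal.ofReal t ≠ 0 := by simpa using ht
  have e : t ^ β = t ^ (β - 2) * t * t := by
    rw [← Real.rpow_add_one ht.ne', ← Real.rpow_add_one ht.ne']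
    ring_nf
  rw [e, ENNReal.ofReal_mul (by positivity), ENNReal.ofReal_mul (by positivity), div_eq_mul_inv]
  calc _ = 2 * (ENNReal.ofReal (t ^ (β - 2)) * ENNReal.ofReal t * v) *
        (ENNReal.ofReal t * (ENNReal.ofReal t)⁻¹) := by
        rw [ENNReal.mul_inv_cancel h0 (by simp)]
        ring
    _ = _ := by ring

lemma rpow_mul_yInv_le (hΦ : IsOrliczFn Φ) (hβ0 : 0 < β) (V : ℝ≥0∞) {u : ℝ} (hu : 0 < u) :
    ENNReal.ofReal (u ^ β) * yInv Φ (V / ENNReal.ofReal u) ≤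
      4 * ∫⁻ t in Ioi u,
        ENNReal.ofReal (t ^ β) * yInv Φ (V / ENNReal.ofReal t) / ENNReal.ofReal t := by
  set m := yInv Φ (V / ENNReal.ofReal u) with hm
  have h2u : ENNReal.ofReal (2 * u) = 2 * ENNReal.ofReal u := by
    rw [ENNReal.ofReal_mul zero_le_two, ENNReal.ofReal_ofNat]
  have hu0 : ENNReal.ofReal u ≠ 0 := by simpa using hu
  have hmle : m ≤ 2 * yInv Φ (V / ENNReal.ofReal (2 * u)) := by
    refine (hΦ.yInv_le_two_mul _).trans (le_of_eq ?_)
    rw [h2u, div_eq_mul_inv, div_eq_mul_inv, div_eq_mul_inv,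
      ENNReal.mul_inv (by simp) (by simp), mul_assoc, mul_comm (2⁻¹ : ℝ≥0∞)]
  have hpt : ∀ t ∈ Ioc u (2 * u),
      ENNReal.ofReal (u ^ β) * yInv Φ (V / ENNReal.ofReal (2 * u)) / ENNReal.ofReal (2 * u) ≤
        ENNReal.ofReal (t ^ β) * yInv Φ (V / ENNReal.ofReal t) / ENNReal.ofReal t := by
    intro t ht
    have := ht.1.le
    have := ht.2
    gcongr ?_ * ?_ / ?_
    · exact ENNReal.ofReal_le_ofReal (Real.rpow_le_rpow hu.le ht.1.le hβ0.le)
    · exact hΦ.yInv_mono (by gcongr)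
    · exact ENNReal.ofReal_le_ofReal ht.2
  calc ENNReal.ofReal (u ^ β) * m
      ≤ ENNReal.ofReal (u ^ β) * (2 * yInv Φ (V / ENNReal.ofReal (2 * u))) := by gcongr
    _ = 4 * (ENNReal.ofReal (u ^ β) * yInv Φ (V / ENNReal.ofReal (2 * u)) /
          ENNReal.ofReal (2 * u) * ENNReal.ofReal u) := by
      generalize yInv Φ (V / ENNReal.ofReal (2 * u)) = m'
      rw [h2u, div_eq_mul_inv, ENNReal.mul_inv (by simp) (by simp)]
      calc _ = 2 * (ENNReal.ofReal (u ^ β) * m') *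
            (2 * 2⁻¹) * (ENNReal.ofReal u * (ENNReal.ofReal u)⁻¹) := by
            rw [ENNReal.mul_inv_cancel hu0 (by simp), ENNReal.mul_inv_cancel (by simp) (by simp)]
            ring
        _ = 2 * 2 * (ENNReal.ofReal (u ^ β) * m' * (2⁻¹ * (ENNReal.ofReal u)⁻¹) *
            ENNReal.ofReal u) := by ring
        _ = _ := by norm_num
    _ = 4 * ∫⁻ _ in Ioc u (2 * u), ENNReal.ofReal (u ^ β) *
          yInv Φ (V / ENNReal.ofReal (2 * u)) / ENNReal.ofReal (2 * u) := by
      rw [setLIntegral_const, Real.volume_Ioc, two_mul u, add_sub_cancel_right]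
    _ ≤ 4 * ∫⁻ t in Ioc u (2 * u),
          ENNReal.ofReal (t ^ β) * yInv Φ (V / ENNReal.ofReal t) / ENNReal.ofReal t := by
      gcongr 4 * ?_
      exact setLIntegral_mono' measurableSet_Ioc hpt
    _ ≤ _ := by
      gcongr
      exact Ioc_subset_Ioi_self

lemma lintegral_lintegral_volBall_le (hn : n ≠ 0) (hβ0 : 0 < β) (hβ1 : β < 1)
    {g : Eu n → ℝ≥0∞} (hg : Measurable g) {u : ℝ} (hu : 0 < u) :
    ∫⁻ x, ∫⁻ y in volBall x u, g y * radialKer β (x - y) ≤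
      ENNReal.ofReal (1 / β + 1 / (1 - β)) * ENNReal.ofReal (u ^ β) * ∫⁻ y, g y := by
  have hset : MeasurableSet {p : Eu n × Eu n | p.2 ∈ volBall p.1 u} :=
    measurableSet_lt (continuous_ballVol.measurable.comp (by fun_prop)) measurable_const
  calc ∫⁻ x, ∫⁻ y in volBall x u, g y * radialKer β (x - y)
      = ∫⁻ x, ∫⁻ y, {p : Eu n × Eu n | p.2 ∈ volBall p.1 u}.indicator
          (fun p ↦ g p.2 * radialKer β (p.1 - p.2)) (x, y) := by
        refine lintegral_congr fun x ↦ ?_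
        rw [← lintegral_indicator (measurableSet_volBall x u)]
        rfl
    _ = ∫⁻ y, ∫⁻ x, {p : Eu n × Eu n | p.2 ∈ volBall p.1 u}.indicator
          (fun p ↦ g p.2 * radialKer β (p.1 - p.2)) (x, y) :=
        lintegral_lintegral_swap ((measurable_mul_radialKer hg).indicator hset).aemeasurable
    _ = ∫⁻ y, g y * ∫⁻ x in volBall y u, radialKer β (y - x) := by
        refine lintegral_congr fun y ↦ ?_
        have hker : Measurable fun x ↦ radialKer β (y - x) :=
          (measurable_radialKer β).comp (by fun_prop)
        rw [← lintegral_const_mul _ hker,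
          ← lintegral_indicator (measurableSet_volBall y u)]
        refine lintegral_congr fun x ↦ ?_
        by_cases h : x ∈ volBall y u
        · simp [indicator, h, mem_volBall_comm.1 h, radialKer_sub_comm β x y]
        · have h' : y ∉ volBall x u := fun h' ↦ h (mem_volBall_comm.1 h')
          simp [indicator, h, h']
    _ ≤ ∫⁻ y, g y * (ENNReal.ofReal (1 / β + 1 / (1 - β)) * ENNReal.ofReal (u ^ β)) := by
        gcongr with y
        exact lintegral_volBall_radialKer_le hn hβ0 hβ1 y hu
    _ = _ := by rw [lintegral_mul_const _ hg, mul_comm]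

/-- The constant in the weak-type estimate for `pot`. -/
def nearConst (β : ℝ) (C : ℝ≥0∞) : ℝ≥0∞ := 2 * C + 8 * C * ENNReal.ofReal (1 / β + 1 / (1 - β))

lemma pot_le (hn : n ≠ 0) (hβ0 : 0 < β) (hβ1 : β < 1) (hΦ : IsOrliczFn Φ) {V C Y : ℝ≥0∞}
    (hV0 : V ≠ 0) (hV1 : V ≠ ∞) {u : ℝ} (hu : 0 < u)
    (h5 : ∫⁻ t in Ioi u, ENNReal.ofReal (t ^ β) * yInv Φ (V / ENNReal.ofReal t) /
      ENNReal.ofReal t ≤ C * Y)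
    {g : Eu n → ℝ≥0∞} (hg : Measurable g) (hgV : ∫⁻ x, Φ (g x) ≤ V) (x : Eu n) :
    pot β g x ≤ 2 * (C * Y) + (ENNReal.ofReal (1 / β + 1 / (1 - β)) * ENNReal.ofReal (u ^ β) *
        yInv Φ (V / ENNReal.ofReal u) +
      ∫⁻ y in volBall x u, {y | yInv Φ (V / ENNReal.ofReal u) < g y}.indicator g y *
        radialKer β (x - y)) := by
  set m := yInv Φ (V / ENNReal.ofReal u) with hm
  have hmset : MeasurableSet {y | m < g y} := measurableSet_lt measurable_const hg
  have hker : Measurable fun y ↦ radialKer β (x - y) :=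
    (measurable_radialKer β).comp (by fun_prop)
  rw [pot, ← lintegral_add_compl _ (measurableSet_volBall x u), add_comm]
  refine add_le_add ?_ ?_
  · refine (lintegral_compl_volBall_le β hg x hu).trans ?_
    calc ∫⁻ t in Ioi u, ENNReal.ofReal (t ^ (β - 2)) * ∫⁻ y in volBall x t, g y
        ≤ ∫⁻ t in Ioi u, 2 * (ENNReal.ofReal (t ^ β) * yInv Φ (V / ENNReal.ofReal t) /
            ENNReal.ofReal t) := by
          refine setLIntegral_mono' measurableSet_Ioi fun t ht ↦ ?_
          have ht0 : 0 < t := hu.trans ht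
          rw [← ofReal_rpow_mul_two_mul _ ht0]
          gcongr
          refine hΦ.lintegral_le _ ?_ (by simpa using ht0) (by simp) hV0 hV1
            ((setLIntegral_le_lintegral _ _).trans hgV)
          rw [Measure.restrict_apply_univ, volume_volBall hn x ht0]
      _ = 2 * ∫⁻ t in Ioi u, (ENNReal.ofReal (t ^ β) * yInv Φ (V / ENNReal.ofReal t) /
            ENNReal.ofReal t) := lintegral_const_mul' _ _ (by simp)
      _ ≤ _ := by gcongr
  · calc ∫⁻ y in volBall x u, g y * radialKer β (x - y)
        ≤ ∫⁻ y in volBall x u, (radialKer β (x - y) * m +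
            {y | m < g y}.indicator g y * radialKer β (x - y)) := by
          refine lintegral_mono fun y ↦ ?_
          rcases le_or_gt (g y) m with h | h
          · refine le_add_right ?_
            rw [mul_comm]
            gcongr
          · refine le_add_left ?_
            rw [indicator_of_mem (by exact h)]
      _ = (∫⁻ y in volBall x u, radialKer β (x - y)) * m + ∫⁻ y in volBall x u,
            {y | m < g y}.indicator g y * radialKer β (x - y) := by
          rw [lintegral_add_left (hker.mul_const _), lintegral_mul_const _ hker]
      _ ≤ _ := by
          gcongr
          exact lintegral_volBall_radialKer_le hn hβ0 hβ1 x hu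

lemma nearConst_ne_zero {C : ℝ≥0∞} (hC : C ≠ 0) : nearConst β C ≠ 0 := by
  simp [nearConst, hC]

lemma nearConst_ne_top {C : ℝ≥0∞} (hC : C ≠ ∞) : nearConst β C ≠ ∞ := by
  unfold nearConst
  finiteness

lemma mul_measure_lt_le (hn : n ≠ 0) (hβ0 : 0 < β) (hβ1 : β < 1) (hΦ : IsOrliczFn Φ)
    (hΨ : IsOrliczFn Ψ) {V W C : ℝ≥0∞} (hV0 : V ≠ 0) (hV1 : V ≠ ∞) (hC0 : C ≠ 0) (hC1 : C ≠ ∞)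
    (h5 : ∀ u : ℝ, 0 < u → ∫⁻ t in Ioi u, ENNReal.ofReal (t ^ β) *
      yInv Φ (V / ENNReal.ofReal t) / ENNReal.ofReal t ≤ C * yInv Ψ (W / ENNReal.ofReal u))
    {g : Eu n → ℝ≥0∞} (hg : Measurable g) (hgV : ∫⁻ x, Φ (g x) ≤ V) {m : ℝ≥0∞} (hm0 : m ≠ 0)
    (hm1 : m ≠ ∞) :
    m * volume {x | W / V * Φ m < Ψ (pot β g x / nearConst β C)} ≤
      ∫⁻ y, {y | m < g y}.indicator g y := by
  have hΦ0 : Φ m ≠ 0 := (hΦ.pos (pos_iff_ne_zero.2 hm0)).ne'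
  have hΦ1 : Φ m ≠ ∞ := hΦ.finite m hm1
  set u : ℝ := (V / Φ m).toReal with hu_def
  have hu0 : V / Φ m ≠ 0 := (ENNReal.div_pos hV0 hΦ1).ne'
  have hu1 : V / Φ m ≠ ∞ := ENNReal.div_ne_top hV1 hΦ0
  have hu : 0 < u := ENNReal.toReal_pos hu0 hu1
  have hu' : ENNReal.ofReal u = V / Φ m := ENNReal.ofReal_toReal hu1
  have hVu : V / ENNReal.ofReal u = Φ m := by
    rw [hu', div_eq_mul_inv, ENNReal.inv_div (Or.inl hΦ1) (Or.inl hΦ0),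
      ENNReal.mul_div_cancel hV0 hV1]
  have hWu : W / ENNReal.ofReal u = W / V * Φ m := by
    rw [hu', div_eq_mul_inv W, ENNReal.inv_div (Or.inl hΦ1) (Or.inl hΦ0)]
    simp only [div_eq_mul_inv]
    ring
  set A : ℝ≥0∞ := ENNReal.ofReal (1 / β + 1 / (1 - β)) with hA
  have hβ' := sub_pos.2 hβ1
  have hA0 : A ≠ 0 := by
    have : 0 < 1 / β + 1 / (1 - β) := by positivity
    simpa [hA] using this
  have huβ : ENNReal.ofReal (u ^ β) ≠ 0 := by
    have := Real.rpow_pos_of_pos hu β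
    simpa using this
  set Y := yInv Ψ (W / V * Φ m) with hY
  have h5u := h5 u hu
  rw [hWu] at h5u
  have hlow : ENNReal.ofReal (u ^ β) * m ≤ 4 * (C * Y) := by
    have := rpow_mul_yInv_le hΦ hβ0 V hu
    rw [hVu, hΦ.yInv_apply] at this
    exact this.trans (by gcongr)
  set B := A * ENNReal.ofReal (u ^ β) with hB
  have hB0 : B ≠ 0 := mul_ne_zero hA0 huβ
  have hB1 : B ≠ ∞ := by finiteness
  set I : Eu n → ℝ≥0∞ := fun x ↦ ∫⁻ y in volBall x u, {y | m < g y}.indicator g y *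
    radialKer β (x - y) with hI
  have hind : Measurable ({y | m < g y}.indicator g) :=
    hg.indicator (measurableSet_lt measurable_const hg)
  have hsub : {x | W / V * Φ m < Ψ (pot β g x / nearConst β C)} ⊆ {x | B * m ≤ I x} := by
    intro x hx
    rw [mem_ofPred_eq] at hx ⊢
    by_contra! hlt
    refine absurd hx (not_lt.2 ?_)
    rw [← hΨ.le_yInv_iff, ENNReal.div_le_iff (nearConst_ne_zero hC0) (nearConst_ne_top hC1)]
    have h1 := pot_le hn hβ0 hβ1 hΦ hV0 hV1 hu h5u hg hgV x
    rw [hVu, hΦ.yInv_apply] at h1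
    calc pot β g x ≤ 2 * (C * Y) + (B * m + B * m) := h1.trans (by gcongr)
      _ = 2 * (C * Y) + 2 * A * (ENNReal.ofReal (u ^ β) * m) := by rw [hB]; ring
      _ ≤ 2 * (C * Y) + 2 * A * (4 * (C * Y)) := by gcongr
      _ = Y * nearConst β C := by rw [nearConst]; ring
  have hM : B * m * volume {x | B * m ≤ I x} ≤ B * ∫⁻ y, {y | m < g y}.indicator g y := by
    refine (mul_meas_ge_le_lintegral₀ ?_ _).trans
      (lintegral_lintegral_volBall_le hn hβ0 hβ1 hind hu)
    have hset : MeasurableSet {p : Eu n × Eu n | p.2 ∈ volBall p.1 u} :=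
      measurableSet_lt (continuous_ballVol.measurable.comp (by fun_prop)) measurable_const
    have h2 := ((measurable_mul_radialKer (β := β) hind).indicator hset).lintegral_prod_right'
      (ν := volume)
    refine Measurable.aemeasurable ?_
    convert! h2 using 2 with x
    exact (lintegral_indicator (measurableSet_volBall x u) _).symm
  rw [mul_assoc] at hM
  have hM' := (ENNReal.mul_le_mul_iff_right hB0 hB1).1 hM
  exact le_trans (by gcongr) hM'

/-- Modular estimate for the potential of a function supported near the origin. -/
lemma lintegral_pot_le (hn : n ≠ 0) (hβ0 : 0 < β) (hβ1 : β < 1) (hΦ : IsOrliczFn Φ)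
    (hΨ : IsOrliczFn Ψ) {V W C a : ℝ≥0∞} (hV0 : V ≠ 0) (hV1 : V ≠ ∞) (hW0 : W ≠ 0) (hW1 : W ≠ ∞)
    (hC0 : C ≠ 0) (hC1 : C ≠ ∞) (ha : 2 ≤ a) (ha1 : a ≠ ∞)
    (hnabla : ∀ w, 2 * a * Φ w ≤ Φ (a * w))
    (h5 : ∀ u : ℝ, 0 < u → ∫⁻ t in Ioi u, ENNReal.ofReal (t ^ β) *
      yInv Φ (V / ENNReal.ofReal t) / ENNReal.ofReal t ≤ C * yInv Ψ (W / ENNReal.ofReal u))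
    {g : Eu n → ℝ≥0∞} (hg : Measurable g) (hgV : ∫⁻ x, Φ (a * g x) ≤ V) :
    ∫⁻ x, Ψ (pot β g x / nearConst β C) ≤ 2 * a * W := by
  have ha' : 1 < a := lt_of_lt_of_le (by norm_num) ha
  have ha0 : a ≠ 0 := (zero_lt_one.trans ha').ne'
  have hgV' : ∫⁻ x, Φ (g x) ≤ V := by
    refine (lintegral_mono fun x ↦ hΦ.strictMono.monotone ?_).trans hgV
    exact le_mul_of_one_le_left' ha'.le
  set c := W / V with hc
  have hc0 : c ≠ 0 := (ENNReal.div_pos hW0 hV1).ne'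
  have hc1 : c ≠ ∞ := ENNReal.div_ne_top hW1 hV0
  set F : Eu n → ℝ≥0∞ := fun x ↦ Ψ (pot β g x / nearConst β C) with hF
  have hFm : Measurable F := hΨ.measurable.comp ((measurable_pot hg).div_const _)
  have hset : ∀ j : ℤ, MeasurableSet {x | c * Φ (a ^ j) < F x} := fun j ↦
    measurableSet_lt measurable_const hFm
  have hpt : ∀ x, F x ≤ ∑' j : ℤ, {x | c * Φ (a ^ j) < F x}.indicator
      (fun _ ↦ c * Φ (a ^ (j + 1))) x := by
    intro x
    have h1 := hΦ.apply_le_tsum ha' ha1 (yInv Φ (F x / c))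
    rw [hΦ.apply_yInv] at h1
    calc F x = c * (F x / c) := (ENNReal.mul_div_cancel hc0 hc1).symm
      _ ≤ _ := mul_le_mul_right h1 c
      _ = _ := by
        rw [← ENNReal.tsum_mul_left]
        refine tsum_congr fun j ↦ ?_
        have : Φ (a ^ j) < F x / c ↔ c * Φ (a ^ j) < F x := by
          rw [ENNReal.lt_div_iff_mul_lt (Or.inl hc0) (Or.inl hc1), mul_comm]
        by_cases h : c * Φ (a ^ j) < F x
        · rw [indicator_of_mem (by exact this.2 h), indicator_of_mem (by exact h)]
        · rw [indicator_of_notMem (by exact fun h' ↦ h (this.1 h')),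
            indicator_of_notMem (by exact h), mul_zero]
  have hlev : ∀ j : ℤ, volume {x | c * Φ (a ^ j) < F x} ≤
      (a ^ j)⁻¹ * ∫⁻ y, {y | a ^ j < g y}.indicator g y := by
    intro j
    have hz0 : a ^ j ≠ 0 := (ENNReal.zpow_pos ha0 ha1 j).ne'
    have hz1 : a ^ j ≠ ∞ := (ENNReal.zpow_lt_top ha0 ha1 j).ne
    have h1 := mul_measure_lt_le hn hβ0 hβ1 hΦ hΨ hV0 hV1 hC0 hC1 h5 hg hgV' hz0 hz1
    calc volume {x | c * Φ (a ^ j) < F x}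
        = (a ^ j)⁻¹ * (a ^ j * volume {x | c * Φ (a ^ j) < F x}) := by
          rw [← mul_assoc, ENNReal.inv_mul_cancel hz0 hz1, one_mul]
      _ ≤ _ := by gcongr
  calc ∫⁻ x, F x ≤ ∫⁻ x, ∑' j : ℤ, {x | c * Φ (a ^ j) < F x}.indicator
        (fun _ ↦ c * Φ (a ^ (j + 1))) x := lintegral_mono hpt
    _ = ∑' j : ℤ, c * Φ (a ^ (j + 1)) * volume {x | c * Φ (a ^ j) < F x} := by
      rw [lintegral_tsum fun j ↦ (measurable_const.indicator (hset j)).aemeasurable]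
      exact tsum_congr fun j ↦ lintegral_indicator_const (hset j) _
    _ ≤ ∑' j : ℤ, c * Φ (a ^ (j + 1)) *
          ((a ^ j)⁻¹ * ∫⁻ y, {y | a ^ j < g y}.indicator g y) :=
      ENNReal.tsum_le_tsum fun j ↦ mul_le_mul_right (hlev j) _
    _ = ∑' j : ℤ, ∫⁻ y, c * (Ioi (a ^ j)).indicator
          (fun w ↦ Φ (a ^ (j + 1)) * (a ^ j)⁻¹ * w) (g y) := by
      refine tsum_congr fun j ↦ ?_
      rw [← mul_assoc, ← lintegral_const_mul _
        (hg.indicator (measurableSet_lt measurable_const hg))]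
      refine lintegral_congr fun y ↦ ?_
      by_cases h : a ^ j < g y <;> simp [indicator, h, mul_assoc]
    _ = ∫⁻ y, ∑' j : ℤ, c * (Ioi (a ^ j)).indicator
          (fun w ↦ Φ (a ^ (j + 1)) * (a ^ j)⁻¹ * w) (g y) := by
      refine (lintegral_tsum fun j ↦ Measurable.aemeasurable ?_).symm
      refine (Measurable.comp (Measurable.indicator ?_ measurableSet_Ioi) hg).const_mul c
      exact measurable_id.const_mul _
    _ ≤ ∫⁻ y, c * (2 * a) * Φ (a * g y) := by
      refine lintegral_mono fun y ↦ ?_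
      rw [ENNReal.tsum_mul_left, mul_assoc]
      exact mul_le_mul_right (hΦ.tsum_indicator_le ha ha1 hnabla (g y)) c
    _ = c * (2 * a) * ∫⁻ y, Φ (a * g y) := lintegral_const_mul' _ _ (by finiteness)
    _ ≤ c * (2 * a) * V := by gcongr
    _ = 2 * a * W := by
      rw [mul_comm c, mul_assoc, hc, ENNReal.div_mul_cancel hV0 hV1]

end Near

section Riesz

variable {n : ℕ} {Φ Ψ : ℝ≥0∞ → ℝ≥0∞} {α lam mu : ℝ}

/-- The Riesz potential of a `[0,∞]`-valued function. -/
def lrieszPot (α : ℝ) (g : Eu n → ℝ≥0∞) (x : Eu n) : ℝ≥0∞ :=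
  ∫⁻ y, g y * ENNReal.ofReal (‖x - y‖ ^ (α - n))

/-- The constant comparing the Riesz kernel with `radialKer`. -/
def rieszConst (n : ℕ) (α : ℝ) : ℝ≥0∞ :=
  ENNReal.ofReal ((1 - α / n) * unitVol n ^ (1 - α / n))

lemma enorm_riesz_le (f : Eu n → ℝ) (x : Eu n) :
    ‖riesz α f x‖ₑ ≤ lrieszPot α (fun y ↦ ‖f y‖ₑ) x := by
  refine (enorm_integral_le_lintegral_enorm _).trans (le_of_eq (lintegral_congr fun y ↦ ?_))
  have h : 0 ≤ ‖x - y‖ ^ (α - n) := by positivity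
  rw [div_eq_mul_inv, ← Real.rpow_neg (norm_nonneg _), neg_sub, enorm_mul,
    Real.enorm_of_nonneg h]

lemma ofReal_rpow_norm_sub_le (hαn : α < n) {r : ℝ} (hr : 0 < r) {x y : Eu n} (hx : ‖x‖ < r)
    (hy : 2 * r ≤ ‖y‖) :
    ENNReal.ofReal (‖x - y‖ ^ (α - n)) ≤
      ENNReal.ofReal (2 ^ (n - α)) * ENNReal.ofReal (‖y‖ ^ (α - n)) := by
  have hy0 : 0 < ‖y‖ := by linarith
  rw [← ENNReal.ofReal_mul (by positivity)]
  apply ENNReal.ofReal_le_ofReal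
  have h1 : ‖y‖ / 2 ≤ ‖x - y‖ := by
    have := norm_sub_norm_le y x
    rw [norm_sub_rev] at this
    linarith
  calc ‖x - y‖ ^ (α - n) ≤ (‖y‖ / 2) ^ (α - n) :=
        Real.rpow_le_rpow_of_nonpos (by positivity) h1 (by linarith)
    _ = 2 ^ (n - α) * ‖y‖ ^ (α - n) := by
      rw [Real.div_rpow hy0.le zero_le_two, ← neg_sub (n : ℝ) α, Real.rpow_neg zero_le_two,
        div_inv_eq_mul, mul_comm]

lemma lintegral_compl_mul_ofReal_rpow_le (hn : n ≠ 0) (hαn : α < n) (hΦ : IsOrliczFn Φ)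
    {g : Eu n → ℝ≥0∞} (hg : Measurable g)
    (H : ∀ t : ℝ, 0 < t → ∫⁻ y in volBall 0 t, Φ (g y) ≤ ENNReal.ofReal (t ^ lam))
    {r : ℝ} (hr : 0 < r) {x : Eu n} (hx : ‖x‖ < r) :
    ∫⁻ y in (volBall 0 (unitVol n * (2 * r) ^ n))ᶜ, g y * ENNReal.ofReal (‖x - y‖ ^ (α - n)) ≤
      ENNReal.ofReal (2 ^ (n - α)) * rieszConst n α * 2 *
        ∫⁻ t in Ioi (unitVol n * (2 * r) ^ n), ENNReal.ofReal (t ^ (α / n)) *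
          yInv Φ (ENNReal.ofReal (t ^ (lam - 1))) / ENNReal.ofReal t := by
  have hκ := unitVol_pos (n := n)
  set R := unitVol n * (2 * r) ^ n with hR
  have hR0 : 0 < R := by positivity
  have hK : ENNReal.ofReal (2 ^ (n - α)) * rieszConst n α ≠ ∞ := by
    unfold rieszConst
    finiteness
  calc ∫⁻ y in (volBall 0 R)ᶜ, g y * ENNReal.ofReal (‖x - y‖ ^ (α - n))
      ≤ ∫⁻ y in (volBall 0 R)ᶜ, ENNReal.ofReal (2 ^ (n - α)) * rieszConst n α *
          (g y * radialKer (α / n) (0 - y)) := by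
        refine setLIntegral_mono' (measurableSet_volBall 0 R).compl fun y hy ↦ ?_
        rw [← ball_eq_volBall hn 0 (by positivity), mem_compl_iff, mem_ball_zero_iff,
          not_lt] at hy
        calc g y * ENNReal.ofReal (‖x - y‖ ^ (α - n))
            ≤ g y * (ENNReal.ofReal (2 ^ (n - α)) *
                (rieszConst n α * radialKer (α / n) (0 - y))) := by
              gcongr
              refine (ofReal_rpow_norm_sub_le hαn hr hx hy).trans ?_
              gcongr
              have := ofReal_rpow_norm_le_radialKer hn hαn (0 - y)
              rwa [zero_sub, norm_neg, ← zero_sub] at this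
          _ = _ := by ring
    _ = ENNReal.ofReal (2 ^ (n - α)) * rieszConst n α *
          ∫⁻ y in (volBall 0 R)ᶜ, g y * radialKer (α / n) (0 - y) := lintegral_const_mul' _ _ hK
    _ ≤ ENNReal.ofReal (2 ^ (n - α)) * rieszConst n α *
          ∫⁻ t in Ioi R, 2 * (ENNReal.ofReal (t ^ (α / n)) *
            yInv Φ (ENNReal.ofReal (t ^ (lam - 1))) / ENNReal.ofReal t) := by
        refine mul_le_mul_right ?_ _
        refine (lintegral_compl_volBall_le _ hg 0 hR0).trans ?_
        refine setLIntegral_mono' measurableSet_Ioi fun t ht ↦ ?_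
        have ht0 : 0 < t := hR0.trans ht
        rw [← ofReal_rpow_mul_two_mul _ ht0]
        gcongr
        have h1 := hΦ.lintegral_le (volume.restrict (volBall 0 t)) (g := g)
          (T := ENNReal.ofReal t) (v := ENNReal.ofReal (t ^ lam))
          (by rw [Measure.restrict_apply_univ, volume_volBall hn 0 ht0]) (by simpa using ht0)
          (by simp) (by simpa using Real.rpow_pos_of_pos ht0 lam) (by simp) (H t ht0)
        rwa [← ENNReal.ofReal_div_of_pos ht0, ← Real.rpow_sub_one ht0.ne'] at h1
    _ = _ := by rw [lintegral_const_mul' _ _ (by simp)]; ring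

/-- The modular form of the boundedness of the Riesz potential. -/
lemma exists_lintegral_lrieszPot_le (hn : n ≠ 0) (hα : 0 < α) (hαn : α < n) (hΦ : IsOrliczFn Φ)
    (hΨ : IsOrliczFn Ψ) (hmu1 : mu ≤ 1) {C₄ C₅ : ℝ} (hC₅ : 1 ≤ C₅)
    (h4 : ∀ u : ℝ, 0 < u →
      (∫⁻ s in Ioi u,
        ENNReal.ofReal (s ^ (α / n)) * yInv Φ (ENNReal.ofReal (s ^ (lam - 1))) /
          ENNReal.ofReal s) ≤ ENNReal.ofReal C₄ * yInv Ψ (ENNReal.ofReal (u ^ (mu - 1))))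
    (h5 : ∀ u : ℝ, 0 < u → ∀ r : ℝ, 0 < r →
      (∫⁻ s in Ioi u,
        ENNReal.ofReal (s ^ (α / n)) * yInv Φ (ENNReal.ofReal (r ^ lam / s)) /
          ENNReal.ofReal s) ≤ ENNReal.ofReal C₅ * yInv Ψ (ENNReal.ofReal (r ^ mu / u)))
    {a : ℝ≥0∞} (ha : 2 ≤ a) (ha1 : a ≠ ∞) (hnabla : ∀ w, 2 * a * Φ w ≤ Φ (a * w)) :
    ∃ C : ℝ≥0∞, C ≠ ∞ ∧ ∀ g : Eu n → ℝ≥0∞, Measurable g →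
      (∀ t : ℝ, 0 < t → ∫⁻ y in volBall 0 t, Φ (a * g y) ≤ ENNReal.ofReal (t ^ lam)) →
      ∀ r : ℝ, 0 < r → ∫⁻ x in ball 0 r, Ψ (lrieszPot α g x / C) ≤
        volume (ball (0 : Eu n) r) ^ mu := by
  have hn' : (0 : ℝ) < n := by positivity
  have hβ0 : 0 < α / n := by positivity
  have hβ1 : α / n < 1 := by rwa [div_lt_one hn']
  have hκ := unitVol_pos (n := n)
  have hc0 : rieszConst n α ≠ 0 := by
    have := sub_pos.2 hβ1
    have : 0 < (1 - α / n) * unitVol n ^ (1 - α / n) := by positivity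
    simpa [rieszConst] using this
  have hc1 : rieszConst n α ≠ ∞ := by simp [rieszConst]
  have hC0 : ENNReal.ofReal C₅ ≠ 0 := by
    have := zero_lt_one.trans_le hC₅
    simpa using this
  set M := nearConst (α / n) (ENNReal.ofReal C₅) with hM
  have hM0 : M ≠ 0 := nearConst_ne_zero hC0
  have hM1 : M ≠ ∞ := nearConst_ne_top (by simp)
  set A := ENNReal.ofReal (2 ^ (n - α)) * rieszConst n α * 2 * ENNReal.ofReal C₄ with hA
  have hA1 : A ≠ ∞ := by finiteness
  set L := rieszConst n α * M + A with hL
  have hL0 : L ≠ 0 := by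
    simp [hL, hc0, hM0]
  have hL1 : L ≠ ∞ := by finiteness
  set K : ℝ≥0∞ := 2 * a * 2 ^ n with hK
  have hK1 : 1 ≤ K := by
    have h1 : (1 : ℝ≥0∞) ≤ 2 := by norm_num
    calc (1 : ℝ≥0∞) = 1 * 1 * 1 := by simp
      _ ≤ 2 * a * 2 ^ n := by
        gcongr
        · exact h1.trans ha
        · exact one_le_pow₀ h1
  have hK0 : K ≠ 0 := (zero_lt_one.trans_le hK1).ne'
  have hKt : K ≠ ∞ := by finiteness
  refine ⟨L * 2 * K, by finiteness, fun g hg H r hr ↦ ?_⟩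
  have ha1' : 1 ≤ a := le_trans (by norm_num) ha
  have H' : ∀ t : ℝ, 0 < t → ∫⁻ y in volBall 0 t, Φ (g y) ≤ ENNReal.ofReal (t ^ lam) :=
    fun t ht ↦ (lintegral_mono fun y ↦
      hΦ.strictMono.monotone (le_mul_of_one_le_left' ha1')).trans (H t ht)
  set R := unitVol n * (2 * r) ^ n with hR
  have hR0 : 0 < R := by positivity
  set ω := unitVol n * r ^ n with hω
  have hω0 : 0 < ω := by positivity
  have hRω : R = 2 ^ n * ω := by rw [hR, hω, mul_pow]; ring
  set g₁ := (volBall 0 R).indicator g with hg₁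
  have hg₁m : Measurable g₁ := hg.indicator (measurableSet_volBall 0 R)
  set Y := yInv Ψ (ENNReal.ofReal (R ^ (mu - 1))) with hY
  have hnear : ∫⁻ x, Ψ (pot (α / n) g₁ x / M) ≤ 2 * a * ENNReal.ofReal (R ^ mu) := by
    have hpos : ∀ s : ℝ, ENNReal.ofReal (R ^ s) ≠ 0 := fun s ↦ by
      simpa using Real.rpow_pos_of_pos hR0 s
    refine lintegral_pot_le hn hβ0 hβ1 hΦ hΨ (hpos lam) (by simp) (hpos mu) (by simp) hC0
      (by simp) ha ha1 hnabla (fun u hu ↦ ?_) hg₁m ?_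
    · rw [← ENNReal.ofReal_div_of_pos hu]
      refine le_trans (le_of_eq ?_) (h5 u hu R hR0)
      refine setLIntegral_congr_fun measurableSet_Ioi fun t ht ↦ ?_
      rw [ENNReal.ofReal_div_of_pos (hu.trans ht)]
    · refine le_trans (le_of_eq ?_) (H R hR0)
      rw [← lintegral_indicator (measurableSet_volBall 0 R)]
      refine lintegral_congr fun y ↦ ?_
      by_cases h : y ∈ volBall 0 R <;> simp [hg₁, indicator, h, hΦ.map_zero]
  have hpt : ∀ x ∈ ball (0 : Eu n) r,
      Ψ (lrieszPot α g x / (L * 2)) ≤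
        (Ψ (pot (α / n) g₁ x / M) + ENNReal.ofReal (R ^ (mu - 1))) / 2 := by
    intro x hx
    rw [mem_ball_zero_iff] at hx
    set P := pot (α / n) g₁ x / M with hP
    have hPM : pot (α / n) g₁ x = M * P := (ENNReal.mul_div_cancel hM0 hM1).symm
    have h1 : ∫⁻ y in volBall 0 R, g y * ENNReal.ofReal (‖x - y‖ ^ (α - n)) ≤
        rieszConst n α * (M * P) := by
      rw [← hPM, pot, ← lintegral_const_mul' _ _ hc1,
        ← lintegral_indicator (measurableSet_volBall 0 R)]
      refine lintegral_mono fun y ↦ ?_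
      by_cases h : y ∈ volBall 0 R
      · rw [hg₁, indicator_of_mem h, indicator_of_mem h, mul_left_comm]
        gcongr
        exact ofReal_rpow_norm_le_radialKer hn hαn (x - y)
      · simp [indicator, h]
    have h2 := lintegral_compl_mul_ofReal_rpow_le hn hαn hΦ hg H' hr hx
    have h3 : lrieszPot α g x ≤ L * (P + Y) := by
      rw [lrieszPot, ← lintegral_add_compl _ (measurableSet_volBall 0 R)]
      calc _ ≤ rieszConst n α * (M * P) + ENNReal.ofReal (2 ^ (n - α)) * rieszConst n α * 2 *
            (ENNReal.ofReal C₄ * Y) := by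
            refine add_le_add h1 (h2.trans ?_)
            gcongr
            exact h4 R hR0
        _ = rieszConst n α * M * P + A * Y := by rw [hA]; ring
        _ ≤ (rieszConst n α * M + A) * P + (rieszConst n α * M + A) * Y := by
            gcongr
            · exact le_self_add
            · exact le_add_self
        _ = L * (P + Y) := by rw [hL]; ring
    have h4' : lrieszPot α g x / (L * 2) ≤ (P + Y) / 2 := by
      refine ENNReal.div_le_of_le_mul (h3.trans (le_of_eq ?_))
      calc L * (P + Y) = L * ((P + Y) / 2 * 2) := by
            rw [ENNReal.div_mul_cancel (by simp) (by simp)]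
        _ = _ := by ring
    refine (hΨ.strictMono.monotone h4').trans ((hΨ.apply_midpoint_le P Y).trans ?_)
    rw [hY, hΨ.apply_yInv]
  have hvol : volume (ball (0 : Eu n) r) = ENNReal.ofReal ω := volume_ball_eq 0 hr
  have hωR : ω ≤ R := by
    rw [hRω]
    exact le_mul_of_one_le_left hω0.le (one_le_pow₀ one_le_two)
  have hRmu : R ^ mu ≤ 2 ^ n * ω ^ mu := by
    rw [hRω, Real.mul_rpow (by positivity) hω0.le]
    gcongr
    calc ((2 : ℝ) ^ n) ^ mu ≤ ((2 : ℝ) ^ n) ^ (1 : ℝ) :=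
          Real.rpow_le_rpow_of_exponent_le (one_le_pow₀ one_le_two) hmu1
      _ = 2 ^ n := Real.rpow_one _
  have h_int : ∫⁻ x in ball 0 r, Ψ (lrieszPot α g x / (L * 2)) ≤
      2 * a * ENNReal.ofReal (R ^ mu) := by
    calc ∫⁻ x in ball 0 r, Ψ (lrieszPot α g x / (L * 2))
        ≤ ∫⁻ x in ball (0 : Eu n) r,
            (Ψ (pot (α / n) g₁ x / M) + ENNReal.ofReal (R ^ (mu - 1))) * 2⁻¹ :=
          setLIntegral_mono' measurableSet_ball hpt
      _ = ((∫⁻ x in ball (0 : Eu n) r, Ψ (pot (α / n) g₁ x / M)) +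
            ENNReal.ofReal (R ^ (mu - 1)) * ENNReal.ofReal ω) * 2⁻¹ := by
          rw [lintegral_mul_const' _ _ (by simp), lintegral_add_right _ measurable_const,
            setLIntegral_const, hvol]
      _ ≤ (2 * a * ENNReal.ofReal (R ^ mu) + 2 * a * ENNReal.ofReal (R ^ mu)) * 2⁻¹ := by
          refine mul_le_mul_left (add_le_add ?_ ?_) _
          · exact (setLIntegral_le_lintegral _ _).trans hnear
          · have e : R ^ mu = R ^ (mu - 1) * R := by
              rw [← Real.rpow_add_one hR0.ne']
              ring_nf
            calc ENNReal.ofReal (R ^ (mu - 1)) * ENNReal.ofReal ω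
                ≤ ENNReal.ofReal (R ^ (mu - 1)) * ENNReal.ofReal R := by gcongr
              _ = ENNReal.ofReal (R ^ mu) := by
                rw [e, ← ENNReal.ofReal_mul (by positivity)]
              _ ≤ 2 * a * ENNReal.ofReal (R ^ mu) :=
                le_mul_of_one_le_left' (one_le_mul (by norm_num) ha1')
      _ = 2 * a * ENNReal.ofReal (R ^ mu) := by
          rw [← mul_two, mul_assoc, ENNReal.mul_inv_cancel (by simp) (by simp), mul_one]
  calc ∫⁻ x in ball 0 r, Ψ (lrieszPot α g x / (L * 2 * K))
      ≤ ∫⁻ x in ball 0 r, Ψ (lrieszPot α g x / (L * 2)) * K⁻¹ := by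
        refine lintegral_mono fun x ↦ ?_
        have h1 := hΨ.apply_div_le hK1 (lrieszPot α g x / (L * 2))
        rw [div_eq_mul_inv, div_eq_mul_inv, mul_assoc,
          ← ENNReal.mul_inv (Or.inr hKt) (Or.inr hK0), ← div_eq_mul_inv] at h1
        exact h1
    _ = (∫⁻ x in ball 0 r, Ψ (lrieszPot α g x / (L * 2))) * K⁻¹ :=
        lintegral_mul_const' _ _ (by simp [hK0])
    _ ≤ (K * ENNReal.ofReal (ω ^ mu)) * K⁻¹ := by
        gcongr
        refine h_int.trans ?_
        rw [hK, mul_assoc (2 * a)]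
        gcongr
        refine (ENNReal.ofReal_le_ofReal hRmu).trans (le_of_eq ?_)
        rw [ENNReal.ofReal_mul (by positivity), ENNReal.ofReal_pow zero_le_two,
          ENNReal.ofReal_ofNat]
    _ = volume (ball (0 : Eu n) r) ^ mu := by
        rw [mul_right_comm, ENNReal.mul_inv_cancel hK0 hKt, one_mul, hvol,
          ENNReal.ofReal_rpow_of_pos hω0]

lemma lintegral_volBall_le_of_centralNorm_lt (hn : n ≠ 0) (hΦ : IsOrliczFn Φ) {f : Eu n → ℝ}
    {ε : ℝ≥0∞} (hε : centralNorm Φ lam f < ε) {t : ℝ} (ht : 0 < t) :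
    ∫⁻ y in volBall 0 t, Φ (‖f y‖ₑ / ε) ≤ ENNReal.ofReal (t ^ lam) := by
  obtain ⟨r, hr, htr⟩ := exists_radius hn ht
  have h1 : orliczNorm Φ lam (ball (0 : Eu n) r) f < ε :=
    lt_of_le_of_lt (le_iSup₂ (f := fun (r : ℝ) (_ : 0 < r) ↦
      orliczNorm Φ lam (ball (0 : Eu n) r) f) r hr) hε
  rw [orliczNorm, sInf_lt_iff] at h1
  obtain ⟨δ, ⟨-, -, hδ⟩, hδε⟩ := h1
  have hvol : volume (ball (0 : Eu n) r) = ENNReal.ofReal t := by rw [htr, volume_ball_eq 0 hr]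
  rw [htr, ← ball_eq_volBall hn 0 hr, ← htr]
  rw [hvol, ENNReal.ofReal_rpow_of_pos ht, Real.rpow_neg ht.le,
    ENNReal.ofReal_inv_of_pos (by positivity), mul_comm, ← div_eq_mul_inv] at hδ
  have h2 := (ENNReal.div_le_iff (by simpa using Real.rpow_pos_of_pos ht lam) (by simp)).1 hδ
  rw [one_mul] at h2
  refine (lintegral_mono fun y ↦ hΦ.strictMono.monotone ?_).trans h2
  rw [← enorm_eq_nnnorm]
  gcongr

end Riesz

/-- sufficiency — boundedness of the Riesz potential on central Morrey–Orlicz spaces. -/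
theorem statement14 {n : ℕ} (α : ℝ) (hα : 0 < α) (hαn : α < n)
    (Φ Ψ : ℝ≥0∞ → ℝ≥0∞) (hΦ : IsOrliczFn Φ) (hΨ : IsOrliczFn Ψ) (lam mu : ℝ)
    (hlm : (0 < lam ∧ lam < 1 ∧ 0 < mu ∧ mu < 1 ∧ lam ≠ mu) ∨ (lam = 0 ∧ mu = 0))
    (C₄ C₅ : ℝ) (hC₄ : 1 ≤ C₄) (hC₅ : 1 ≤ C₅)
    (h4 : ∀ u : ℝ, 0 < u →
      (∫⁻ s in Ioi u,
        ENNReal.ofReal (s ^ (α / n)) * yInv Φ (ENNReal.ofReal (s ^ (lam - 1))) /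
          ENNReal.ofReal s) ≤ ENNReal.ofReal C₄ * yInv Ψ (ENNReal.ofReal (u ^ (mu - 1))))
    (h5 : ∀ u : ℝ, 0 < u → ∀ r : ℝ, 0 < r →
      (∫⁻ s in Ioi u,
        ENNReal.ofReal (s ^ (α / n)) * yInv Φ (ENNReal.ofReal (r ^ lam / s)) /
          ENNReal.ofReal s) ≤ ENNReal.ofReal C₅ * yInv Ψ (ENNReal.ofReal (r ^ mu / u)))
    (hΔ : IsDelta2 (yConj Φ)) :
    ∃ C₆ : ℝ, 1 ≤ C₆ ∧ ∀ f : Eu n → ℝ, LocallyIntegrable f volume → centralNorm Φ lam f ≠ ∞ →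
      centralNorm Ψ mu (riesz α f) ≤ ENNReal.ofReal C₆ * centralNorm Φ lam f := by
  have hn' : (0 : ℝ) < n := hα.trans hαn
  have hn : n ≠ 0 := by
    rintro rfl
    simp at hn'
  have hmu : mu ≤ 1 := by
    rcases hlm with ⟨-, -, -, h1, -⟩ | ⟨-, rfl⟩
    · exact h1.le
    · simp
  obtain ⟨a, ha, ha1, hnabla⟩ := hΦ.exists_nabla2 hΔ
  have ha0 : a ≠ 0 := fun e ↦ by simp [e] at ha
  obtain ⟨C, hC1, hC⟩ := exists_lintegral_lrieszPot_le hn hα hαn hΦ hΨ hmu hC₅ h4 h5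
    ha ha1 hnabla
  refine ⟨max 1 (C * a).toReal, le_max_left _ _, fun f hf hN ↦ ?_⟩
  set C₆ : ℝ≥0∞ := ENNReal.ofReal (max 1 (C * a).toReal) with hC₆
  have hC₆1 : 1 ≤ C₆ := by simp [hC₆]
  have hC₆0 : C₆ ≠ 0 := (zero_lt_one.trans_le hC₆1).ne'
  have hC₆t : C₆ ≠ ∞ := ENNReal.ofReal_ne_top
  have hCC₆ : C * a ≤ C₆ := by
    calc C * a = ENNReal.ofReal (C * a).toReal :=
          (ENNReal.ofReal_toReal (ENNReal.mul_ne_top hC1 ha1)).symm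
      _ ≤ C₆ := ENNReal.ofReal_le_ofReal (le_max_right _ _)
  rw [mul_comm, ← ENNReal.div_le_iff hC₆0 hC₆t]
  refine le_of_forall_gt_imp_ge_of_dense fun ε hε ↦ ?_
  rcases eq_or_ne ε ∞ with rfl | hεt
  · exact le_top
  have hε0 : ε ≠ 0 := (bot_le.trans_lt hε).ne'
  rw [ENNReal.div_le_iff hC₆0 hC₆t]
  refine iSup₂_le fun r hr ↦ sInf_le ⟨by positivity, by finiteness, ?_⟩
  have hfm := hf.aestronglyMeasurable
  set f' := hfm.mk f with hf'
  have hff' : f =ᵐ[volume] f' := hfm.ae_eq_mk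
  have hf'm : Measurable f' := hfm.stronglyMeasurable_mk.measurable
  set g : Eu n → ℝ≥0∞ := fun y ↦ ‖f' y‖ₑ / (a * ε) with hg
  have hag : ∀ y, a * g y = ‖f' y‖ₑ / ε := fun y ↦ by
    rw [hg]
    beta_reduce
    rw [← mul_div_assoc, ENNReal.mul_div_mul_left _ _ ha0 ha1]
  have hgm : Measurable g := hf'm.enorm.div_const _
  have hmod := hC g hgm (fun t ht ↦ by
    refine le_trans (le_of_eq ?_) (lintegral_volBall_le_of_centralNorm_lt hn hΦ hε ht)
    refine lintegral_congr_ae ?_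
    filter_upwards [ae_restrict_of_ae hff'] with y hy
    rw [hag, hy]) r hr
  have hpt : ∀ x, (‖riesz α f x‖₊ : ℝ≥0∞) / (ε * C₆) ≤ lrieszPot α g x / C := by
    intro x
    have h1 : lrieszPot α (fun y ↦ ‖f y‖ₑ) x = a * ε * lrieszPot α g x := by
      rw [lrieszPot, lrieszPot, ← lintegral_const_mul' _ _ (by finiteness)]
      refine lintegral_congr_ae ?_
      filter_upwards [hff'] with y hy
      rw [hy, ← mul_assoc, hg]
      beta_reduce
      rw [ENNReal.mul_div_cancel (mul_ne_zero ha0 hε0) (by finiteness)]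
    have h2 := enorm_riesz_le (α := α) f x
    rw [h1] at h2
    rw [← enorm_eq_nnnorm]
    calc ‖riesz α f x‖ₑ / (ε * C₆) ≤ a * ε * lrieszPot α g x / (ε * (C * a)) := by gcongr
      _ = (ε * a) * lrieszPot α g x / ((ε * a) * C) := by ring_nf
      _ = _ := ENNReal.mul_div_mul_left _ _ (mul_ne_zero hε0 ha0) (by finiteness)
  have hv0 : volume (ball (0 : Eu n) r) ≠ 0 := (measure_ball_pos _ _ hr).ne'
  have hvt : volume (ball (0 : Eu n) r) ≠ ∞ := measure_ball_lt_top.ne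
  calc volume (ball (0 : Eu n) r) ^ (-mu) *
        ∫⁻ x in ball (0 : Eu n) r, Ψ ((‖riesz α f x‖₊ : ℝ≥0∞) / (ε * C₆))
      ≤ volume (ball (0 : Eu n) r) ^ (-mu) * volume (ball (0 : Eu n) r) ^ mu := by
        gcongr
        exact (lintegral_mono fun x ↦ hΨ.strictMono.monotone (hpt x)).trans hmod
    _ = 1 := by rw [← ENNReal.rpow_add _ _ hv0 hvt, neg_add_cancel, ENNReal.rpow_zero]
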